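/- arXiv:2403.17364 — 2 statements merged into one kernel-verified Lean document; each statement's English description precedes it below -/
import Mathlib

section
/- Let E be a real finite-dimensional inner product space, let f : E → ℝ be differentiable with L-Lipschitz gradient, let λ > L, and for each x ∈ E let p(x) denote the unique minimizer over E of y ↦ f(y) + (λ/2)‖y − x‖². Then the proximal map p : E → E is Lipschitz with constant λ/(λ − L): for all x₁, x₂ ∈ E, ‖p(x₁) − p(x₂)‖ ≤ (λ/(λ − L))‖x₁ − x₂‖. -/
/-- First-order optimality condition for the proximal problem. -/
theorem gradient_eq_smul_sub_of_isMinOn_prox {E : Type*} [NormedAddCommGroup E]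
    [InnerProductSpace ℝ E] [CompleteSpace E] {f : E → ℝ} {lam : ℝ} {x y : E}
    (hf : DifferentiableAt ℝ f y)
    (hy : IsMinOn (fun z : E => f z + lam / 2 * ‖z - x‖ ^ 2) Set.univ y) :
    gradient f y = lam • (x - y) := by
  have hmin : IsLocalMin (fun z : E => f z + lam / 2 * ‖z - x‖ ^ 2) y :=
    hy.isLocalMin Filter.univ_mem
  have hquad := ((hasFDerivAt_id (𝕜 := ℝ) y).sub_const x).norm_sq.const_mul (lam / 2)
  have hzero := hmin.hasFDerivAt_eq_zero (hf.hasGradientAt.hasFDerivAt.add hquad)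
  refine ext_inner_right ℝ fun v => ?_
  have hv := congrArg (fun T : E →L[ℝ] ℝ => T v) hzero
  simp only [add_apply, smul_apply,
    ContinuousLinearMap.comp_apply, InnerProductSpace.toDual_apply_apply, innerSL_apply_apply,
    ContinuousLinearMap.id_apply, zero_apply, id_eq, smul_eq_mul,
    nsmul_eq_mul, inner_sub_left] at hv
  rw [real_inner_smul_left, inner_sub_left]
  push_cast at hv
  linarith

/-- **Lipschitz continuity of the proximal map.**
If `f` is differentiable with `L`-Lipschitz gradient, `lam > L`, and `p x` is the unique
minimizer of `y ↦ f y + (lam/2)‖y - x‖²` for every `x`, then the proximal map `p` is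
Lipschitz with constant `lam / (lam - L)`. -/
theorem stmt_4 {E : Type*} [NormedAddCommGroup E] [InnerProductSpace ℝ E]
    [FiniteDimensional ℝ E]
    (f : E → ℝ) (hf : Differentiable ℝ f)
    (L : ℝ)
    (hlip : ∀ x y : E, ‖gradient f x - gradient f y‖ ≤ L * ‖x - y‖)
    (lam : ℝ) (hlam : L < lam)
    (p : E → E)
    (hp : ∀ x : E, IsMinOn (fun y : E => f y + lam / 2 * ‖y - x‖ ^ 2) Set.univ (p x)) :
    ∀ x₁ x₂ : E, ‖p x₁ - p x₂‖ ≤ (lam / (lam - L)) * ‖x₁ - x₂‖ := by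
  have : CompleteSpace E := FiniteDimensional.complete ℝ E
  intro x₁ x₂
  rcases eq_or_ne x₁ x₂ with rfl | hne
  · simp
  have hL : 0 ≤ L := nonneg_of_mul_nonneg_left ((norm_nonneg _).trans (hlip x₁ x₂))
    (norm_pos_iff.2 (sub_ne_zero.2 hne))
  have hlam_pos : 0 < lam := hL.trans_lt hlam
  have h₁ := gradient_eq_smul_sub_of_isMinOn_prox (hf (p x₁)) (hp x₁)
  have h₂ := gradient_eq_smul_sub_of_isMinOn_prox (hf (p x₂)) (hp x₂)
  have hsplit : lam • (p x₁ - p x₂) =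
      lam • (x₁ - x₂) - (gradient f (p x₁) - gradient f (p x₂)) := by
    rw [h₁, h₂]
    module
  have hbound : lam * ‖p x₁ - p x₂‖ ≤ lam * ‖x₁ - x₂‖ + L * ‖p x₁ - p x₂‖ := by
    calc lam * ‖p x₁ - p x₂‖ = ‖lam • (p x₁ - p x₂)‖ := by
          rw [norm_smul, Real.norm_of_nonneg hlam_pos.le]
      _ ≤ ‖lam • (x₁ - x₂)‖ + ‖gradient f (p x₁) - gradient f (p x₂)‖ := by
          rw [hsplit]
          exact norm_sub_le _ _
      _ ≤ lam * ‖x₁ - x₂‖ + L * ‖p x₁ - p x₂‖ := by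
          rw [norm_smul, Real.norm_of_nonneg hlam_pos.le]
          gcongr
          exact hlip _ _
  rw [div_mul_eq_mul_div, le_div_iff₀ (sub_pos.2 hlam)]
  linarith
end

section
/- Let E be a real finite-dimensional inner product space, let f : E → ℝ be differentiable with L-Lipschitz gradient, attaining its infimum f* at some point, and satisfying the PL inequality with constant μ > 0: f(x) − f* ≤ (μ/2)‖∇f(x)‖² for all x. Let λ > L, let p(x) denote the unique minimizer over E of y ↦ f(y) + (λ/2)‖y − x‖², define the Moreau envelope f_λ(x) := f(p(x)) + (λ/2)‖p(x) − x‖², and set L_λ := λL/(λ − L). Let 0 < α ≤ 1/L_λ and for x ∈ E define the proximal-gradient step x⁺ := x − αλ(x − p(x)). Then: (i) f_λ(x⁺) ≤ f_λ(x) − (α/2)‖λ(x − p(x))‖²; and (ii) f_λ(x⁺) − f* ≤ (1 − αλ/(μλ + 1))·(f_λ(x) − f*). -/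
open scoped RealInnerProductSpace in
/-- The descent lemma: a function with `L`-Lipschitz gradient lies below its quadratic upper
model. -/
theorem le_quadratic_of_lipschitz_gradient {E : Type*} [NormedAddCommGroup E]
    [InnerProductSpace ℝ E] [CompleteSpace E] {f : E → ℝ} (hf : Differentiable ℝ f) {L : ℝ}
    (hlip : ∀ x y : E, ‖gradient f x - gradient f y‖ ≤ L * ‖x - y‖) (a v : E) :
    f (a + v) ≤ f a + ⟪gradient f a, v⟫ + L / 2 * ‖v‖ ^ 2 := by
  have hderiv : ∀ t : ℝ, HasDerivAt
      (fun t : ℝ => f (a + t • v) - t * ⟪gradient f a, v⟫ - L / 2 * ‖v‖ ^ 2 * t ^ 2)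
      (⟪gradient f (a + t • v) - gradient f a, v⟫ - L * ‖v‖ ^ 2 * t) t := by
    intro t
    have hline : HasDerivAt (fun t : ℝ => a + t • v) v t := by
      simpa using ((hasDerivAt_id t).smul_const v).const_add a
    have hcomp := (hf (a + t • v)).hasGradientAt.hasFDerivAt.comp_hasDerivAt t hline
    rw [InnerProductSpace.toDual_apply_apply] at hcomp
    refine ((hcomp.sub ((hasDerivAt_id t).mul_const ⟪gradient f a, v⟫)).sub
      ((hasDerivAt_pow 2 t).const_mul (L / 2 * ‖v‖ ^ 2))).congr_deriv ?_
    rw [inner_sub_left]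
    push_cast
    ring
  have hanti : AntitoneOn
      (fun t : ℝ => f (a + t • v) - t * ⟪gradient f a, v⟫ - L / 2 * ‖v‖ ^ 2 * t ^ 2)
      (Set.Icc 0 1) := by
    refine antitoneOn_of_deriv_nonpos (convex_Icc 0 1)
      (fun t _ => (hderiv t).continuousAt.continuousWithinAt)
      (fun t _ => (hderiv t).differentiableAt.differentiableWithinAt) fun t ht => ?_
    rw [interior_Icc] at ht
    rw [(hderiv t).deriv, sub_nonpos]
    calc ⟪gradient f (a + t • v) - gradient f a, v⟫
        ≤ ‖gradient f (a + t • v) - gradient f a‖ * ‖v‖ := real_inner_le_norm _ _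
      _ ≤ L * ‖a + t • v - a‖ * ‖v‖ := by gcongr; exact hlip _ _
      _ = L * ‖v‖ ^ 2 * t := by
        rw [add_sub_cancel_left, norm_smul, Real.norm_of_nonneg ht.1.le]
        ring
  have h := hanti (by simp) (by simp) zero_le_one
  simp only [one_smul, zero_smul, add_zero, one_mul, zero_mul, sub_zero, one_pow, mul_one,
    zero_pow two_ne_zero, mul_zero] at h
  linarith

/-- The gradient at a proximal point. -/
theorem gradient_eq_smul_of_isMinOn_prox {E : Type*} [NormedAddCommGroup E]
    [InnerProductSpace ℝ E] [CompleteSpace E] {f : E → ℝ} {lam : ℝ} {x q : E}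
    (hf : DifferentiableAt ℝ f q)
    (hq : IsMinOn (fun y : E => f y + lam / 2 * ‖y - x‖ ^ 2) Set.univ q) :
    gradient f q = lam • (x - q) := by
  have hsq := (((hasFDerivAt_id q).sub_const x).norm_sq).const_mul (lam / 2)
  have hzero := (hq.isLocalMin Filter.univ_mem).hasFDerivAt_eq_zero
    (hf.hasGradientAt.hasFDerivAt.add hsq)
  refine ext_inner_right ℝ fun v => ?_
  have hv : inner ℝ (gradient f q) v + lam / 2 * (2 * inner ℝ (q - x) v) = 0 := by
    simpa [inner_sub_left] using congrArg (fun T : E →L[ℝ] ℝ => T v) hzero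
  rw [inner_sub_left] at hv
  rw [real_inner_smul_left, inner_sub_left]
  linarith

/-- **Descent and linear contraction of the Moreau envelope along a proximal-gradient
step** (Proposition 10, descent part). For `f` `L`-smooth, PL with constant `μ`,
attaining its infimum `f xstar`, `lam > L`, step size `0 < α ≤ 1 / L_lam` with
`L_lam = lam L / (lam - L)`, and `x⁺ = x - α lam (x - p x)`:
(i) `f_lam x⁺ ≤ f_lam x - (α/2)‖lam (x - p x)‖²`, and
(ii) `f_lam x⁺ - f* ≤ (1 - α lam / (μ lam + 1)) (f_lam x - f*)`. -/
theorem stmt_10 {E : Type*} [NormedAddCommGroup E] [InnerProductSpace ℝ E]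
    [FiniteDimensional ℝ E]
    (f : E → ℝ) (hf : Differentiable ℝ f)
    (L : ℝ)
    (hlip : ∀ x y : E, ‖gradient f x - gradient f y‖ ≤ L * ‖x - y‖)
    (fstar : ℝ) (xstar : E) (hfstar : fstar = f xstar)
    (hmin : ∀ y : E, fstar ≤ f y)
    (μ : ℝ) (hμ : 0 < μ)
    (hPL : ∀ x : E, f x - fstar ≤ μ / 2 * ‖gradient f x‖ ^ 2)
    (lam : ℝ) (hlam : L < lam)
    (p : E → E)
    (hp : ∀ x : E, IsMinOn (fun y : E => f y + lam / 2 * ‖y - x‖ ^ 2) Set.univ (p x))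
    (flam : E → ℝ) (hflam : ∀ x : E, flam x = f (p x) + lam / 2 * ‖p x - x‖ ^ 2)
    (Llam : ℝ) (hLlam : Llam = lam * L / (lam - L))
    (α : ℝ) (hα : 0 < α) (hα' : α ≤ 1 / Llam)
    (x xplus : E) (hxplus : xplus = x - (α * lam) • (x - p x)) :
    flam xplus ≤ flam x - α / 2 * ‖lam • (x - p x)‖ ^ 2 ∧
      flam xplus - fstar ≤ (1 - α * lam / (μ * lam + 1)) * (flam x - fstar) := by
  obtain hE | hE := subsingleton_or_nontrivial E
  · have hxp : x - p x = 0 := Subsingleton.elim _ _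
    have hflam_eq : ∀ z, flam z = fstar := fun z => by
      rw [hflam, hfstar, Subsingleton.elim (p z) xstar, Subsingleton.elim xstar z]
      simp
    simp [hflam_eq, hxp]
  have hL_nonneg : 0 ≤ L := by
    obtain ⟨a, b, hab⟩ := exists_pair_ne E
    have hpos : 0 < ‖a - b‖ := norm_pos_iff.mpr (sub_ne_zero.mpr hab)
    exact nonneg_of_mul_nonneg_left ((norm_nonneg _).trans (hlip a b)) hpos
  have hL : 0 < L := by
    refine hL_nonneg.lt_of_ne' fun h0 => ?_
    simp [hLlam, h0] at hα'
    linarith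
  have hlam_pos : 0 < lam := hL.trans hlam
  have hαL : α * L ≤ 1 := by
    have h1 : 1 / Llam ≤ 1 / L := by
      have h2 : L ≤ Llam := by
        rw [hLlam, le_div_iff₀ (sub_pos.mpr hlam)]
        nlinarith
      exact one_div_le_one_div_of_le hL h2
    exact (le_div_iff₀ hL).mp (hα'.trans h1)
  have hgrad := gradient_eq_smul_of_isMinOn_prox (hf (p x)) (hp x)
  obtain ⟨g, hg⟩ : ∃ g, g = lam • (x - p x) := ⟨_, rfl⟩
  rw [← hg] at hgrad ⊢
  have hnorm : ‖g‖ ^ 2 = lam ^ 2 * ‖p x - x‖ ^ 2 := by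
    rw [hg, norm_smul, mul_pow, norm_sub_rev, Real.norm_eq_abs, sq_abs]
  have hdescent : flam xplus ≤ flam x - α / 2 * ‖g‖ ^ 2 := by
    have h1 := isMinOn_univ_iff.mp (hp xplus) (p x + -α • g)
    have h2 := le_quadratic_of_lipschitz_gradient hf hlip (p x) (-α • g)
    have h3 : p x + -α • g - xplus = p x - x := by
      rw [hxplus, hg, smul_smul]
      module
    rw [hgrad, inner_smul_right, real_inner_self_eq_norm_sq, norm_smul, mul_pow,
      Real.norm_eq_abs, sq_abs] at h2
    simp only [h3] at h1
    rw [hflam, hflam]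
    nlinarith [mul_nonneg (mul_nonneg hα.le (sub_nonneg.mpr hαL)) (sq_nonneg ‖g‖)]
  refine ⟨hdescent, ?_⟩
  have hPLx := hPL (p x)
  rw [hgrad] at hPLx
  have hden : 0 < μ * lam + 1 := by positivity
  have hgap : lam / (μ * lam + 1) * (flam x - fstar) ≤ ‖g‖ ^ 2 / 2 := by
    rw [div_mul_eq_mul_div, div_le_iff₀ hden, hflam]
    nlinarith [mul_le_mul_of_nonneg_left hPLx hlam_pos.le]
  have hstep := mul_le_mul_of_nonneg_left hgap hα.le
  have hassoc : α * lam / (μ * lam + 1) = α * (lam / (μ * lam + 1)) := mul_div_assoc _ _ _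
  rw [hassoc]
  linarith
end
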